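/- Let Ω ⊂ ℝ^d be a nonempty, bounded, open set, 0 < s < 1, 1 ≤ p < ∞, and let α, β ≥ 0 satisfy α + β < d − dim̄_M(∂Ω). For n ∈ ℕ let v_n(x) = max{min{2 − n d_Ω(x), 1}, 0}. Then there exists a constant C > 0, independent of n and f, such that for all f ∈ L^∞(Ω) and all n ∈ ℕ: [f v_n]^p_{W^{s,p;α,β}(Ω)} ≤ C ‖f‖_∞^p n^{sp} ∫_{Ω_{3/n}} d_Ω(x)^{−α−β} dx + C ∫_{Ω_{3/n}} ∫_{Ω_{3/n}} |f(x)−f(y)|^p |x−y|^{−d−sp} d_Ω(x)^{−α} d_Ω(y)^{−β} dy dx, where Ω_r = {x ∈ Ω : d_Ω(x) ≤ r}. -/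

import Mathlib

open MeasureTheory Metric Set Filter
open scoped ENNReal NNReal

noncomputable section

/-- Euclidean space `ℝ^d`. -/
abbrev Rd (d : ℕ) := EuclideanSpace ℝ (Fin d)

/-- `d_Ω(x)`: the distance from `x` to the boundary `∂Ω`. -/
def distBd {d : ℕ} (Ω : Set (Rd d)) (x : Rd d) : ℝ := Metric.infDist x (frontier Ω)

/-- The `p`-th power of the weighted Gagliardo seminorm `[f]_{W^{s,p;α,β}(Ω)}^p`, with
power-of-distance-to-the-boundary weights `d_Ω(y)^{-β} d_Ω(x)^{-α}`. -/
def gagP {d : ℕ} (Ω : Set (Rd d)) (s p α β : ℝ) (f : Rd d → ℝ) : ℝ≥0∞ :=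
  ∫⁻ x in Ω, ∫⁻ y in Ω, ENNReal.ofReal
    (|f x - f y| ^ p / dist x y ^ ((d : ℝ) + s * p)
      * distBd Ω y ^ (-β) * distBd Ω x ^ (-α))

/-- The weighted Gagliardo seminorm `[f]_{W^{s,p;α,β}(Ω)}`. -/
def gagSemi {d : ℕ} (Ω : Set (Rd d)) (s p α β : ℝ) (f : Rd d → ℝ) : ℝ≥0∞ :=
  gagP Ω s p α β f ^ (1 / p)

/-- Membership in the weighted fractional Sobolev space `W^{s,p;α,β}(Ω)`. -/
def memW {d : ℕ} (Ω : Set (Rd d)) (s p α β : ℝ) (f : Rd d → ℝ) : Prop :=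
  MemLp f (ENNReal.ofReal p) (volume.restrict Ω) ∧ gagP Ω s p α β f < ⊤

/-- The norm `‖f‖_{L^p(Ω)} + [f]_{W^{s,p;α,β}(Ω)}` (as an extended real). -/
def wNorm {d : ℕ} (Ω : Set (Rd d)) (s p α β : ℝ) (f : Rd d → ℝ) : ℝ≥0∞ :=
  eLpNorm f (ENNReal.ofReal p) (volume.restrict Ω) + gagSemi Ω s p α β f

/-- Membership in `W_0^{s,p;α,β}(Ω)`: the closure of `C_c^∞(Ω) ∩ W^{s,p;α,β}(Ω)` in
`W^{s,p;α,β}(Ω)`. -/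
def memW0 {d : ℕ} (Ω : Set (Rd d)) (s p α β : ℝ) (f : Rd d → ℝ) : Prop :=
  memW Ω s p α β f ∧ ∀ ε : ℝ, 0 < ε → ∃ φ : Rd d → ℝ,
    ContDiff ℝ (⊤ : ℕ∞) φ ∧ HasCompactSupport φ ∧ tsupport φ ⊆ Ω ∧ memW Ω s p α β φ ∧
    wNorm Ω s p α β (fun x => f x - φ x) < ENNReal.ofReal ε

/-- The defining set for the lower Assouad codimension: admissible exponents `q`. -/
def lowerCodimSet {d : ℕ} (E : Set (Rd d)) : Set ℝ :=
  {q : ℝ | 0 ≤ q ∧ ∃ C : ℝ, 1 ≤ C ∧ ∀ x ∈ E, ∀ r R : ℝ, 0 < r → r < R →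
    ENNReal.ofReal R < EMetric.diam E →
    volume (Metric.cthickening r E ∩ Metric.ball x R)
      ≤ ENNReal.ofReal (C * (r / R) ^ q) * volume (Metric.ball x R)}

/-- The lower Assouad codimension. -/
def lowerCodimA {d : ℕ} (E : Set (Rd d)) : ℝ := sSup (lowerCodimSet E)

/-- The upper Assouad codimension. -/
def upperCodimA {d : ℕ} (E : Set (Rd d)) : ℝ :=
  sInf {q : ℝ | 0 ≤ q ∧ ∃ c : ℝ, 0 < c ∧ ∀ x ∈ E, ∀ r R : ℝ, 0 < r → r < R →
    ENNReal.ofReal R < EMetric.diam E →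
    ENNReal.ofReal (c * (r / R) ^ q) * volume (Metric.ball x R)
      ≤ volume (Metric.cthickening r E ∩ Metric.ball x R)}

/-- The upper Minkowski dimension. -/
def upperMinkDim {d : ℕ} (E : Set (Rd d)) : ℝ :=
  sInf {t : ℝ | 0 ≤ t ∧
    Filter.limsup (fun r : ℝ =>
        volume (Metric.cthickening r E) * ENNReal.ofReal (r ^ (t - (d : ℝ))))
      (nhdsWithin 0 (Set.Ioi 0)) = 0}

/-- Uniform domain: any two points are joined by a `1`-Lipschitz (arc-length parameterized)
curve of length `≤ C|x-y|` staying quantitatively away from the boundary. -/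
def IsUniformDomain {d : ℕ} (Ω : Set (Rd d)) : Prop :=
  ∃ C : ℝ, 1 ≤ C ∧ ∀ x ∈ Ω, ∀ y ∈ Ω, ∃ (l : ℝ) (γ : ℝ → Rd d),
    0 ≤ l ∧ l ≤ C * dist x y ∧ γ 0 = x ∧ γ l = y ∧
    (∀ t ∈ Set.Icc 0 l, γ t ∈ Ω) ∧
    LipschitzOnWith 1 γ (Set.Icc 0 l) ∧
    ∀ t ∈ Set.Icc 0 l,
      min (dist (γ t) x) (dist (γ t) y) / C ≤ Metric.infDist (γ t) (frontier Ω)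

/-- `κ`-plumpness. -/
def IsPlump {d : ℕ} (κ : ℝ) (E : Set (Rd d)) : Prop :=
  ∀ r : ℝ, 0 < r → ENNReal.ofReal r < EMetric.diam E →
    ∀ x ∈ closure E, ∃ z ∈ Metric.closedBall x r, Metric.ball z (κ * r) ⊆ E

/-- `σ`-homogeneity: `|V(E,x,λ,r)| ≤ L r^d λ^σ` where
`V(E,x,λ,r) = {y : dist(y,E) ≤ r, |x-y| ≤ λ r}`. -/
def IsHomog {d : ℕ} (σ : ℝ) (E : Set (Rd d)) : Prop :=
  ∃ L : ℝ, 0 < L ∧ ∀ x ∈ E, ∀ lam r : ℝ, 1 ≤ lam → 0 < r →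
    volume (Metric.cthickening r E ∩ Metric.closedBall x (lam * r))
      ≤ ENNReal.ofReal (L * r ^ (d : ℝ) * lam ^ σ)

/-- The axis-parallel cube with corner `a` and side length `l`. -/
def cube {d : ℕ} (a : Rd d) (l : ℝ) : Set (Rd d) :=
  {y | ∀ i, y i ∈ Set.Icc (a i) (a i + l)}

/-- Muckenhoupt `A₁` class: `|Q|⁻¹ ∫_Q w ≤ A inf_Q w` for all cubes `Q`. -/
def IsA1 {d : ℕ} (w : Rd d → ℝ) : Prop :=
  (∀ x, 0 < w x) ∧ ∃ A : ℝ, 0 < A ∧ ∀ (a : Rd d) (l : ℝ), 0 < l →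
    ∫⁻ x in cube a l, ENNReal.ofReal (w x)
      ≤ ENNReal.ofReal (A * l ^ (d : ℝ)) * ⨅ y ∈ cube a l, ENNReal.ofReal (w y)

/-- The `p`-th power of the Gagliardo seminorm with general weights `w(x) v(y)`. -/
def gagPW {d : ℕ} (Ω : Set (Rd d)) (s p : ℝ) (w v f : Rd d → ℝ) : ℝ≥0∞ :=
  ∫⁻ x in Ω, ∫⁻ y in Ω, ENNReal.ofReal
    (|f x - f y| ^ p / dist x y ^ ((d : ℝ) + s * p) * w x * v y)

/-- Membership in `W^{s,p;w,v}(Ω)` for general weights. -/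
def memWgen {d : ℕ} (Ω : Set (Rd d)) (s p : ℝ) (w v f : Rd d → ℝ) : Prop :=
  MemLp f (ENNReal.ofReal p) (volume.restrict Ω) ∧ gagPW Ω s p w v f < ⊤

/-- The norm of `W^{s,p;w,v}(Ω)` (as an extended real). -/
def wNormGen {d : ℕ} (Ω : Set (Rd d)) (s p : ℝ) (w v f : Rd d → ℝ) : ℝ≥0∞ :=
  eLpNorm f (ENNReal.ofReal p) (volume.restrict Ω) + gagPW Ω s p w v f ^ (1 / p)

/-- Membership in `W_0^{s,p;w,v}(Ω)`. -/
def memW0gen {d : ℕ} (Ω : Set (Rd d)) (s p : ℝ) (w v f : Rd d → ℝ) : Prop :=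
  memWgen Ω s p w v f ∧ ∀ ε : ℝ, 0 < ε → ∃ φ : Rd d → ℝ,
    ContDiff ℝ (⊤ : ℕ∞) φ ∧ HasCompactSupport φ ∧ tsupport φ ⊆ Ω ∧ memWgen Ω s p w v φ ∧
    wNormGen Ω s p w v (fun x => f x - φ x) < ENNReal.ofReal ε

/-- Membership in `W_c^{s,p;w,v}(Ω)`: the closure of compactly supported measurable
functions. -/
def memWcgen {d : ℕ} (Ω : Set (Rd d)) (s p : ℝ) (w v f : Rd d → ℝ) : Prop :=
  memWgen Ω s p w v f ∧ ∀ ε : ℝ, 0 < ε → ∃ g : Rd d → ℝ,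
    Measurable g ∧ HasCompactSupport g ∧ tsupport g ⊆ Ω ∧ memWgen Ω s p w v g ∧
    wNormGen Ω s p w v (fun x => f x - g x) < ENNReal.ofReal ε

end

theorem integrable_truncKernel {d : ℕ} (hd : 0 < d) {s p : ℝ} (hs0 : 0 < s) (hs1 : s < 1)
    (hp : 1 ≤ p) :
    Integrable (fun z : Rd d => min 1 ‖z‖ ^ p / ‖z‖ ^ ((d : ℝ) + s * p)) := by
  have : Nonempty (Fin d) := ⟨⟨0, hd⟩⟩
  have hsp : 0 < s * p := by positivity
  rw [integrable_fun_norm_addHaar volume (f := fun r : ℝ => min 1 r ^ p / r ^ ((d : ℝ) + s * p)),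
    finrank_euclideanSpace_fin, ← Ioc_union_Ioi_eq_Ioi zero_le_one, integrableOn_union]
  have key : ∀ y : ℝ, 0 < y → ∀ q : ℝ,
      y ^ (q - s * p - 1) = y ^ (d - 1) • (y ^ q / y ^ ((d : ℝ) + s * p)) := by
    intro y hy q
    rw [smul_eq_mul, ← Real.rpow_sub hy, ← Real.rpow_natCast, ← Real.rpow_add hy,
      Nat.cast_sub hd]
    congr 1
    push_cast
    ring
  constructor
  · have h1 : IntegrableOn (fun y : ℝ => y ^ (p - s * p - 1)) (Ioc 0 1) := by
      rw [← intervalIntegrable_iff_integrableOn_Ioc_of_le zero_le_one]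
      exact intervalIntegral.intervalIntegrable_rpow' (by nlinarith)
    refine h1.congr_fun (fun y hy => ?_) measurableSet_Ioc
    simp only [min_eq_right hy.2]
    exact key y hy.1 p
  · have h1 : IntegrableOn (fun y : ℝ => y ^ (0 - s * p - 1)) (Ioi 1) :=
      integrableOn_Ioi_rpow_of_lt (by linarith) zero_lt_one
    refine h1.congr_fun (fun y hy => ?_) measurableSet_Ioi
    have hy' : (1 : ℝ) < y := hy
    simp only [min_eq_left hy'.le, Real.one_rpow]
    simpa using key y (by linarith) 0

theorem lintegral_scaled_truncKernel {d : ℕ} (s p : ℝ) {a : ℝ} (ha : 0 < a) :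
    ∫⁻ z : Rd d, ENNReal.ofReal (min 1 (a * ‖z‖) ^ p / ‖z‖ ^ ((d : ℝ) + s * p))
      = ENNReal.ofReal (a ^ (s * p)) *
        ∫⁻ z : Rd d, ENNReal.ofReal (min 1 ‖z‖ ^ p / ‖z‖ ^ ((d : ℝ) + s * p)) := by
  set F : Rd d → ℝ≥0∞ := fun z => ENNReal.ofReal (min 1 ‖z‖ ^ p / ‖z‖ ^ ((d : ℝ) + s * p)) with hF
  have hFm : Measurable F := by fun_prop
  have hscale : ∀ z : Rd d,
      ENNReal.ofReal (min 1 (a * ‖z‖) ^ p / ‖z‖ ^ ((d : ℝ) + s * p))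
        = ENNReal.ofReal (a ^ ((d : ℝ) + s * p)) * F (a • z) := by
    intro z
    rw [hF, ← ENNReal.ofReal_mul (by positivity)]
    simp only [norm_smul, Real.norm_of_nonneg ha.le]
    rw [Real.mul_rpow ha.le (norm_nonneg z)]
    have : a ^ ((d : ℝ) + s * p) ≠ 0 := (Real.rpow_pos_of_pos ha _).ne'
    congr 1
    rw [div_mul_eq_div_div_swap, mul_div_cancel₀ _ this]
  have hcomp : ∫⁻ z, F (a • z) = ENNReal.ofReal (a ^ (-(d : ℝ))) * ∫⁻ z, F z := by
    rw [← lintegral_map hFm (measurable_const_smul a),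
      Measure.map_addHaar_smul volume ha.ne', lintegral_smul_measure,
      finrank_euclideanSpace_fin, abs_of_pos (by positivity), Real.rpow_neg ha.le,
      Real.rpow_natCast, smul_eq_mul]
  simp_rw [hscale]
  rw [lintegral_const_mul' _ _ ENNReal.ofReal_ne_top, hcomp, ← mul_assoc,
    ← ENNReal.ofReal_mul (by positivity), ← Real.rpow_add ha]
  congr 3
  ring

theorem rpow_add_le_two_rpow_mul {a b p : ℝ} (ha : 0 ≤ a) (hb : 0 ≤ b) (hp : 1 ≤ p) :
    (a + b) ^ p ≤ 2 ^ (p - 1) * (a ^ p + b ^ p) := by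
  lift a to ℝ≥0 using ha
  lift b to ℝ≥0 using hb
  exact_mod_cast NNReal.rpow_add_le_mul_rpow_add_rpow a b hp

theorem rpow_neg_mul_rpow_neg_le {a b α β : ℝ} (ha : 0 < a) (hab : a ≤ b)
    (hβ : 0 ≤ β) : a ^ (-α) * b ^ (-β) ≤ a ^ (-(α + β)) := by
  rw [neg_add, Real.rpow_add ha]
  gcongr ?_ * ?_
  exact Real.rpow_le_rpow_of_nonpos ha hab (by linarith)

theorem abs_clamp_sub_clamp_le (u w : ℝ) :
    |max (min (2 - u) 1) 0 - max (min (2 - w) 1) 0| ≤ min 1 |u - w| := by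
  refine le_min ?_ ?_
  · rw [abs_le]
    constructor <;> cases max_cases (min (2 - u) 1) 0 <;> cases max_cases (min (2 - w) 1) 0 <;>
      cases min_cases (2 - u) 1 <;> cases min_cases (2 - w) 1 <;> linarith
  · refine (abs_max_sub_max_le_abs _ _ _).trans ?_
    refine (abs_min_sub_min_le_max _ _ _ _).trans ?_
    simp [abs_sub_comm]

theorem abs_cutoff_mul_sub_rpow_le {F G u w M p : ℝ} (hp : 1 ≤ p) (hG : |G| ≤ M) :
    |F * max (min (2 - u) 1) 0 - G * max (min (2 - w) 1) 0| ^ p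
      ≤ 2 ^ (p - 1) * (|F - G| ^ p + M ^ p * min 1 |u - w| ^ p) := by
  have hM : 0 ≤ M := (abs_nonneg G).trans hG
  have h1 : |max (min (2 - u) 1) 0| ≤ 1 := by
    rw [abs_of_nonneg (le_max_right _ _)]
    exact max_le (min_le_right _ _) zero_le_one
  rw [← Real.mul_rpow hM (by positivity)]
  refine le_trans ?_ (rpow_add_le_two_rpow_mul (abs_nonneg _) (by positivity) hp)
  gcongr
  calc |F * max (min (2 - u) 1) 0 - G * max (min (2 - w) 1) 0|
      = |(F - G) * max (min (2 - u) 1) 0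
          + G * (max (min (2 - u) 1) 0 - max (min (2 - w) 1) 0)| := by congr 1; ring
    _ ≤ |F - G| * |max (min (2 - u) 1) 0|
          + |G| * |max (min (2 - u) 1) 0 - max (min (2 - w) 1) 0| := by
        rw [← abs_mul, ← abs_mul]; exact abs_add_le _ _
    _ ≤ |F - G| * 1 + M * min 1 |u - w| := by
        gcongr
        exact abs_clamp_sub_clamp_le u w
    _ = _ := by ring

theorem abs_cutoff_mul_sub_rpow_le_of_le {F G a b r M p n : ℝ} (hp : 1 ≤ p) (hn : 0 < n)
    (hF : |F| ≤ M) (hab : |a - b| ≤ r) (hb : 3 / n < b) :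
    |F * max (min (2 - n * a) 1) 0 - G * max (min (2 - n * b) 1) 0| ^ p
      ≤ 2 ^ (p - 1) * (M ^ p * min 1 (n * r) ^ p) := by
  have hM : 0 ≤ M := (abs_nonneg F).trans hF
  have hr : 0 ≤ r := (abs_nonneg _).trans hab
  have hvb : max (min (2 - n * b) 1) 0 = 0 := by
    rw [div_lt_iff₀ hn] at hb
    exact max_eq_right ((min_le_left _ _).trans (by linarith))
  have h1 : (1 : ℝ) ≤ 2 ^ (p - 1) := Real.one_le_rpow one_le_two (by linarith)
  have h2 := abs_clamp_sub_clamp_le (n * a) (n * b)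
  rw [← mul_sub, abs_mul, abs_of_pos hn, hvb, sub_zero] at h2
  rw [hvb, mul_zero, sub_zero, abs_mul, Real.mul_rpow (abs_nonneg _) (abs_nonneg _)]
  calc |F| ^ p * |max (min (2 - n * a) 1) 0| ^ p
      ≤ M ^ p * min 1 (n * r) ^ p := by
        gcongr
        exact h2.trans (by gcongr)
    _ ≤ 2 ^ (p - 1) * (M ^ p * min 1 (n * r) ^ p) :=
        le_mul_of_one_le_left (by positivity) h1

theorem gagliardo_cutoff_pointwise {d : ℕ} (Ω : Set (Rd d)) {s p α β M : ℝ} {n : ℕ}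
    {f : Rd d → ℝ} (hp : 1 ≤ p) (hα : 0 ≤ α) (hβ : 0 ≤ β) (hn : 0 < n) {x y : Rd d}
    (hx : 0 < distBd Ω x) (hy : 0 < distBd Ω y) (hfx : |f x| ≤ M) (hfy : |f y| ≤ M) :
    ENNReal.ofReal
      (|f x * max (min (2 - (n : ℝ) * distBd Ω x) 1) 0
          - f y * max (min (2 - (n : ℝ) * distBd Ω y) 1) 0| ^ p / dist x y ^ ((d : ℝ) + s * p)
        * distBd Ω y ^ (-β) * distBd Ω x ^ (-α))
      ≤ ENNReal.ofReal (2 ^ (p - 1)) *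
          {z | distBd Ω z ≤ 3 / (n : ℝ)}.indicator (fun x =>
            {z | distBd Ω z ≤ 3 / (n : ℝ)}.indicator (fun y => ENNReal.ofReal
              (|f x - f y| ^ p / dist x y ^ ((d : ℝ) + s * p)
                * distBd Ω x ^ (-α) * distBd Ω y ^ (-β))) y) x
        + ENNReal.ofReal (2 ^ (p - 1) * M ^ p) *
          (ENNReal.ofReal (min 1 (n * dist x y) ^ p / dist x y ^ ((d : ℝ) + s * p)) *
            ({z | distBd Ω z ≤ 3 / (n : ℝ)}.indicator
                (fun x => ENNReal.ofReal (distBd Ω x ^ (-(α + β)))) x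
              + {z | distBd Ω z ≤ 3 / (n : ℝ)}.indicator
                (fun x => ENNReal.ofReal (distBd Ω x ^ (-(α + β)))) y)) := by
  have hM : 0 ≤ M := (abs_nonneg _).trans hfx
  have hn' : (0 : ℝ) < n := by exact_mod_cast hn
  have hlip : |distBd Ω x - distBd Ω y| ≤ dist x y := by
    simpa [Real.dist_eq, distBd] using (lipschitz_infDist_pt (frontier Ω)).dist_le_mul x y
  have hlip' : |distBd Ω y - distBd Ω x| ≤ dist x y := by rwa [abs_sub_comm]
  set a := distBd Ω x
  set b := distBd Ω y
  set D := dist x y ^ ((d : ℝ) + s * p) with hD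
  have hD0 : 0 ≤ D := by positivity
  by_cases hxS : a ≤ 3 / (n : ℝ) <;> by_cases hyS : b ≤ 3 / (n : ℝ)
  · rw [indicator_of_mem (by exact hxS), indicator_of_mem (by exact hyS),
      indicator_of_mem (by exact hxS), indicator_of_mem (by exact hyS),
      ← ENNReal.ofReal_add (by positivity) (by positivity),
      ← ENNReal.ofReal_mul (by positivity), ← ENNReal.ofReal_mul (by positivity),
      ← ENNReal.ofReal_mul (by positivity), ← ENNReal.ofReal_add (by positivity) (by positivity)]
    apply ENNReal.ofReal_le_ofReal
    have hw : a ^ (-α) * b ^ (-β) ≤ a ^ (-(α + β)) + b ^ (-(α + β)) := by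
      rcases le_total a b with hab | hab
      · exact (rpow_neg_mul_rpow_neg_le hx hab hβ).trans (le_add_of_nonneg_right (by positivity))
      · rw [mul_comm, add_comm α]
        exact (rpow_neg_mul_rpow_neg_le hy hab hα).trans (le_add_of_nonneg_left (by positivity))
    have hk : min 1 |n * a - n * b| ≤ min 1 (n * dist x y) := by
      rw [← mul_sub, abs_mul, abs_of_pos hn']
      gcongr
    calc _ ≤ 2 ^ (p - 1) * (|f x - f y| ^ p + M ^ p * min 1 (n * dist x y) ^ p) / D
              * b ^ (-β) * a ^ (-α) := by
          gcongr
          exact (abs_cutoff_mul_sub_rpow_le hp hfy).trans (by gcongr)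
      _ = 2 ^ (p - 1) * (|f x - f y| ^ p / D * a ^ (-α) * b ^ (-β))
            + 2 ^ (p - 1) * M ^ p * (min 1 (n * dist x y) ^ p / D * (a ^ (-α) * b ^ (-β))) := by
          ring
      _ ≤ _ := by gcongr
  · rw [indicator_of_mem (by exact hxS), indicator_of_notMem (by exact hyS),
      indicator_of_mem (by exact hxS), indicator_of_notMem (by exact hyS),
      mul_zero, zero_add, add_zero,
      ← ENNReal.ofReal_mul (by positivity), ← ENNReal.ofReal_mul (by positivity)]
    apply ENNReal.ofReal_le_ofReal
    push Not at hyS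
    calc _ ≤ 2 ^ (p - 1) * (M ^ p * min 1 (n * dist x y) ^ p) / D * b ^ (-β) * a ^ (-α) := by
          gcongr
          exact abs_cutoff_mul_sub_rpow_le_of_le hp hn' hfx hlip hyS
      _ = 2 ^ (p - 1) * M ^ p * (min 1 (n * dist x y) ^ p / D * (a ^ (-α) * b ^ (-β))) := by
          ring
      _ ≤ _ := by
          gcongr
          exact rpow_neg_mul_rpow_neg_le hx (hxS.trans hyS.le) hβ
  · rw [indicator_of_notMem (by exact hxS),
      indicator_of_notMem (by exact hxS), indicator_of_mem (by exact hyS),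
      mul_zero, zero_add, zero_add,
      ← ENNReal.ofReal_mul (by positivity), ← ENNReal.ofReal_mul (by positivity)]
    apply ENNReal.ofReal_le_ofReal
    push Not at hxS
    calc _ ≤ 2 ^ (p - 1) * (M ^ p * min 1 (n * dist x y) ^ p) / D * b ^ (-β) * a ^ (-α) := by
          gcongr
          rw [abs_sub_comm]
          exact abs_cutoff_mul_sub_rpow_le_of_le hp hn' hfy hlip' hxS
      _ = 2 ^ (p - 1) * M ^ p * (min 1 (n * dist x y) ^ p / D * (b ^ (-β) * a ^ (-α))) := by
          ring
      _ ≤ _ := by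
          gcongr
          rw [add_comm α]
          exact rpow_neg_mul_rpow_neg_le hy (hyS.trans hxS.le) hα
  · have hv : ∀ t : ℝ, ¬ t ≤ 3 / (n : ℝ) → max (min (2 - n * t) 1) 0 = 0 := by
      intro t ht
      push Not at ht
      rw [div_lt_iff₀ hn'] at ht
      exact max_eq_right ((min_le_left _ _).trans (by linarith))
    rw [hv a hxS, hv b hyS]
    simp [Real.zero_rpow (by linarith : p ≠ 0)]

theorem measurable_distBd {d : ℕ} (Ω : Set (Rd d)) : Measurable (distBd Ω) :=
  (continuous_infDist_pt _).measurable

theorem lintegral_lintegral_kernel_mul_add_le {X : Type*} [MeasurableSpace X] {μ : Measure X}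
    [SFinite μ] {k : X → X → ℝ≥0∞} (hk : Measurable (Function.uncurry k))
    (hsymm : ∀ x y, k x y = k y x) {J : ℝ≥0∞} (hJ : ∀ x, ∫⁻ y, k x y ∂μ ≤ J)
    {w : X → ℝ≥0∞} (hw : Measurable w) :
    ∫⁻ x, ∫⁻ y, k x y * (w x + w y) ∂μ ∂μ ≤ 2 * J * ∫⁻ x, w x ∂μ := by
  have hone : ∫⁻ x, ∫⁻ y, k x y * w x ∂μ ∂μ ≤ J * ∫⁻ x, w x ∂μ := by
    rw [← lintegral_const_mul _ hw]
    refine lintegral_mono fun x => ?_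
    rw [lintegral_mul_const _ (by fun_prop)]
    gcongr
    exact hJ x
  have htwo : ∫⁻ x, ∫⁻ y, k x y * w y ∂μ ∂μ ≤ J * ∫⁻ x, w x ∂μ := by
    rw [lintegral_lintegral_swap (by fun_prop)]
    simpa only [hsymm] using hone
  calc ∫⁻ x, ∫⁻ y, k x y * (w x + w y) ∂μ ∂μ
      = ∫⁻ x, ∫⁻ y, k x y * w x ∂μ ∂μ + ∫⁻ x, ∫⁻ y, k x y * w y ∂μ ∂μ := by
        rw [← lintegral_add_left (Measurable.lintegral_prod_right'
          (f := fun z : X × X => k z.1 z.2 * w z.1) (by fun_prop))]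
        refine lintegral_congr fun x => ?_
        rw [← lintegral_add_left (by fun_prop)]
        simp_rw [mul_add]
    _ ≤ J * ∫⁻ x, w x ∂μ + J * ∫⁻ x, w x ∂μ := add_le_add hone htwo
    _ = 2 * J * ∫⁻ x, w x ∂μ := by ring

theorem distBd_pos {d : ℕ} (hd : 0 < d) {Ω : Set (Rd d)} (hopen : IsOpen Ω)
    (hbdd : Bornology.IsBounded Ω) {x : Rd d} (hx : x ∈ Ω) : 0 < distBd Ω x := by
  have : Nonempty (Fin d) := ⟨⟨0, hd⟩⟩
  have hfr : (frontier Ω).Nonempty := by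
    rw [nonempty_frontier_iff]
    refine ⟨⟨x, hx⟩, ?_⟩
    rintro rfl
    exact NormedSpace.unbounded_univ ℝ (Rd d) hbdd
  refine (isClosed_frontier.notMem_iff_infDist_pos hfr).1 fun hmem => ?_
  rw [hopen.frontier_eq] at hmem
  exact hmem.2 hx


/-- the cut-off estimate for `f v_n` for bounded `f`, without uniformity,
under `α + β < d - dim_M(∂Ω)`. -/
theorem stmt16 {d : ℕ} (Ω : Set (Rd d)) (hne : Ω.Nonempty)
    (hopen : IsOpen Ω) (hbdd : Bornology.IsBounded Ω) (s p α β : ℝ)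
    (hs0 : 0 < s) (hs1 : s < 1) (hp : 1 ≤ p) (hα0 : 0 ≤ α) (hβ0 : 0 ≤ β)
    (h : α + β < (d : ℝ) - upperMinkDim (frontier Ω)) :
    ∃ C : ℝ, 0 < C ∧ ∀ (f : Rd d → ℝ) (M : ℝ), Measurable f → 0 ≤ M →
      (∀ x ∈ Ω, |f x| ≤ M) → ∀ n : ℕ, 0 < n →
      gagP Ω s p α β (fun x => f x * max (min (2 - (n : ℝ) * distBd Ω x) 1) 0)
        ≤ ENNReal.ofReal (C * M ^ p * (n : ℝ) ^ (s * p)) *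
            (∫⁻ x in {x ∈ Ω | distBd Ω x ≤ 3 / (n : ℝ)},
              ENNReal.ofReal (distBd Ω x ^ (-(α + β))))
          + ENNReal.ofReal C *
            (∫⁻ x in {x ∈ Ω | distBd Ω x ≤ 3 / (n : ℝ)},
              ∫⁻ y in {x ∈ Ω | distBd Ω x ≤ 3 / (n : ℝ)}, ENNReal.ofReal
                (|f x - f y| ^ p / dist x y ^ ((d : ℝ) + s * p)
                  * distBd Ω x ^ (-α) * distBd Ω y ^ (-β))) := by
  rcases Nat.eq_zero_or_pos d with rfl | hd
  · refine ⟨1, one_pos, fun f M _ _ _ n _ => ?_⟩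
    have hzero : gagP Ω s p α β
        (fun x => f x * max (min (2 - (n : ℝ) * distBd Ω x) 1) 0) = 0 := by
      refine lintegral_eq_zero_of_ae_eq_zero (Eventually.of_forall fun x => ?_)
      refine lintegral_eq_zero_of_ae_eq_zero (Eventually.of_forall fun y => ?_)
      rw [Subsingleton.elim y x]
      simp [Real.zero_rpow (by linarith : p ≠ 0)]
    rw [hzero]
    exact zero_le
  set I : ℝ := ∫ z : Rd d, min 1 ‖z‖ ^ p / ‖z‖ ^ ((d : ℝ) + s * p) with hI
  have hI0 : 0 ≤ I := integral_nonneg fun z => by positivity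
  have hIlint : ∫⁻ z : Rd d, ENNReal.ofReal (min 1 ‖z‖ ^ p / ‖z‖ ^ ((d : ℝ) + s * p))
      = ENNReal.ofReal I :=
    (ofReal_integral_eq_lintegral_ofReal (integrable_truncKernel hd hs0 hs1 hp)
      (Eventually.of_forall fun z => by positivity)).symm
  set K : ℝ := 2 ^ (p - 1) with hK
  have hK0 : 0 < K := by positivity
  refine ⟨K + 2 * K * I, by positivity, fun f M hf hM hfM n hn => ?_⟩
  have hn' : (0 : ℝ) < n := by exact_mod_cast hn
  have hδ := measurable_distBd Ω
  set S : Set (Rd d) := {z | distBd Ω z ≤ 3 / (n : ℝ)} with hS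
  have hSm : MeasurableSet S := measurableSet_le hδ measurable_const
  have hA : {x ∈ Ω | distBd Ω x ≤ 3 / (n : ℝ)} = S ∩ Ω := by
    ext z
    simp [hS, and_comm]
  rw [hA, ← Measure.restrict_restrict hSm]
  set μ : Measure (Rd d) := volume.restrict Ω with hμ
  set W : Rd d → ℝ≥0∞ := fun x => ENNReal.ofReal (distBd Ω x ^ (-(α + β))) with hW
  set G : Rd d → Rd d → ℝ≥0∞ := fun x y => ENNReal.ofReal
    (|f x - f y| ^ p / dist x y ^ ((d : ℝ) + s * p)
      * distBd Ω x ^ (-α) * distBd Ω y ^ (-β)) with hG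
  set k : Rd d → Rd d → ℝ≥0∞ := fun x y =>
    ENNReal.ofReal (min 1 (n * dist x y) ^ p / dist x y ^ ((d : ℝ) + s * p)) with hk
  have hWm : Measurable W := by fun_prop
  have hkm : Measurable (Function.uncurry k) := by
    unfold Function.uncurry
    fun_prop
  set H : Rd d → Rd d → ℝ≥0∞ := fun x y =>
    S.indicator (fun x => S.indicator (fun y => G x y) y) x with hH
  have hHm : Measurable (Function.uncurry H) := by
    have heq : Function.uncurry H = (S ×ˢ S).indicator (Function.uncurry G) := by
      ext ⟨x, y⟩
      by_cases hx : x ∈ S <;> by_cases hy : y ∈ S <;> simp [hH, hx, hy]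
    rw [heq]
    refine Measurable.indicator ?_ (hSm.prod hSm)
    unfold Function.uncurry
    fun_prop
  have hHint : ∫⁻ x, ∫⁻ y, H x y ∂μ ∂μ = ∫⁻ x in S, ∫⁻ y in S, G x y ∂μ ∂μ := by
    rw [← lintegral_indicator hSm]
    refine lintegral_congr fun x => ?_
    by_cases hx : x ∈ S <;> simp [hH, hx, lintegral_indicator hSm]
  have hkJ : ∀ x, ∫⁻ y, k x y ∂μ ≤ ENNReal.ofReal ((n : ℝ) ^ (s * p)) * ENNReal.ofReal I := by
    intro x
    refine (setLIntegral_le_lintegral _ _).trans_eq ?_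
    rw [← hIlint, ← lintegral_scaled_truncKernel s p hn']
    simp only [hk, dist_eq_norm]
    exact lintegral_sub_left_eq_self
      (fun z : Rd d => ENNReal.ofReal (min 1 (n * ‖z‖) ^ p / ‖z‖ ^ ((d : ℝ) + s * p))) x
  have hkW : ∫⁻ x, ∫⁻ y, k x y * (S.indicator W x + S.indicator W y) ∂μ ∂μ
      ≤ 2 * (ENNReal.ofReal ((n : ℝ) ^ (s * p)) * ENNReal.ofReal I) * ∫⁻ x in S, W x ∂μ := by
    rw [← lintegral_indicator hSm]
    exact lintegral_lintegral_kernel_mul_add_le hkm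
      (fun x y => by simp only [hk, dist_comm]) hkJ (hWm.indicator hSm)
  calc gagP Ω s p α β (fun x => f x * max (min (2 - (n : ℝ) * distBd Ω x) 1) 0)
      ≤ ∫⁻ x, ∫⁻ y, (ENNReal.ofReal K * H x y
          + ENNReal.ofReal (K * M ^ p) * (k x y * (S.indicator W x + S.indicator W y))) ∂μ ∂μ := by
        refine setLIntegral_mono' hopen.measurableSet fun x hx =>
          setLIntegral_mono' hopen.measurableSet fun y hy => ?_
        exact gagliardo_cutoff_pointwise Ω hp hα0 hβ0 hn (distBd_pos hd hopen hbdd hx)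
          (distBd_pos hd hopen hbdd hy) (hfM x hx) (hfM y hy)
    _ = ENNReal.ofReal K * ∫⁻ x, ∫⁻ y, H x y ∂μ ∂μ
          + ENNReal.ofReal (K * M ^ p) *
            ∫⁻ x, ∫⁻ y, k x y * (S.indicator W x + S.indicator W y) ∂μ ∂μ := by
        rw [← lintegral_const_mul' _ _ ENNReal.ofReal_ne_top,
          ← lintegral_const_mul' _ _ ENNReal.ofReal_ne_top,
          ← lintegral_add_left (hHm.lintegral_prod_right.const_mul _)]
        refine lintegral_congr fun x => ?_
        rw [lintegral_add_left ((hHm.of_uncurry_left (x := x)).const_mul _),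
          lintegral_const_mul' _ _ ENNReal.ofReal_ne_top,
          lintegral_const_mul' _ _ ENNReal.ofReal_ne_top]
    _ ≤ ENNReal.ofReal K * (∫⁻ x in S, ∫⁻ y in S, G x y ∂μ ∂μ)
          + ENNReal.ofReal (K * M ^ p) *
            (2 * (ENNReal.ofReal ((n : ℝ) ^ (s * p)) * ENNReal.ofReal I) * ∫⁻ x in S, W x ∂μ) := by
        rw [hHint]
        exact add_le_add_right (mul_le_mul_right hkW _) _
    _ ≤ _ := by
        rw [add_comm, ← mul_assoc]
        gcongr
        · have h2 : (2 : ℝ≥0∞) = ENNReal.ofReal 2 := by simp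
          rw [h2, ← ENNReal.ofReal_mul (by positivity), ← ENNReal.ofReal_mul (by positivity),
            ← ENNReal.ofReal_mul (by positivity)]
          apply ENNReal.ofReal_le_ofReal
          have : 0 ≤ K * M ^ p * (n : ℝ) ^ (s * p) := by positivity
          linarith
        · have : 0 ≤ 2 * K * I := by positivity
          linarith
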